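/- For every real x > 1 there exist complex numbers L₊ and L₋ such that: w₂(z) → L₊ as z → x within the open upper half-plane intersected with Ω, and w₁(z) → L₊ as z → x within the open lower half-plane intersected with Ω; moreover w₂(z) → L₋ as z → x within the open lower half-plane intersected with Ω, and w₁(z) → L₋ as z → x within the open upper half-plane intersected with Ω. In particular the boundary values satisfy w₂,±(x) = w₁,∓(x) on (1,∞). -/

import Mathlib

open Complex Filter Asymptotics Set

/-- `Ω = ℂ \ ((-∞,0] ∪ [1,∞))`, the complex plane with the two real slits removed. -/
def Ω : Set ℂ := {z : ℂ | z ∉ (fun x : ℝ => (x : ℂ)) '' (Set.Iic 0 ∪ Set.Ici 1)}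

/-- `ω = e^{2πi/3}`. -/
noncomputable def ω : ℂ := Complex.exp (2 * Real.pi * Complex.I / 3)

/-- The principal logarithm, hence any principal power, extends continuously to the negative real
axis from the upper half plane. -/
lemma tendsto_cpow_const_of_im_pos {α : Type*} {l : Filter α} {f : α → ℂ} {a : ℂ}
    (hre : a.re < 0) (him : a.im = 0) (hf : Tendsto f l (nhds a)) (hpos : ∀ᶠ t in l, 0 < (f t).im)
    (s : ℂ) : Tendsto (fun t => f t ^ s) l (nhds (a ^ s)) := by
  have ha : a ≠ 0 := by
    rintro rfl
    simp at hre
  have hwithin : Tendsto f l (nhdsWithin a {z : ℂ | 0 ≤ z.im}) :=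
    tendsto_nhdsWithin_iff.2 ⟨hf, hpos.mono fun t ht => ht.le⟩
  have hlog : Tendsto (fun t => log (f t)) l (nhds (log a)) :=
    (continuousWithinAt_log_of_re_neg_of_im_zero hre him).tendsto.comp hwithin
  have hexp : Tendsto (fun t => exp (log (f t) * s)) l (nhds (a ^ s)) := by
    rw [cpow_def_of_ne_zero ha]
    exact (continuous_exp.tendsto _).comp (hlog.mul_const s)
  refine hexp.congr' (hpos.mono fun t ht => ?_)
  have hne : f t ≠ 0 := fun h => by simp [h] at ht
  exact (cpow_def_of_ne_zero hne s).symm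

lemma log_neg_ofReal {p : ℝ} (hp : 0 < p) : log (-(p : ℂ)) = Real.log p + Real.pi * I := by
  rw [Complex.log, norm_neg, norm_real, Real.norm_of_nonneg hp.le, ← ofReal_neg,
    arg_ofReal_of_neg (neg_lt_zero.2 hp)]

lemma omega_mul_neg_cpow {p q : ℝ} (hp : 0 < p) (hq : 0 < q) (hpq : p * q = 1) :
    ω * (-(p : ℂ)) ^ (-(1 : ℂ) / 3) = (-(q : ℂ)) ^ ((1 : ℂ) / 3) := by
  have hlog : Real.log q = -Real.log p := by
    rw [← Real.log_inv, eq_inv_of_mul_eq_one_right hpq]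
  rw [ω, cpow_def_of_ne_zero (by simpa using hp.ne'), cpow_def_of_ne_zero (by simpa using hq.ne'),
    log_neg_ofReal hp, log_neg_ofReal hq, hlog, ← Complex.exp_add]
  congr 1
  push_cast
  ring

lemma omega_combination_neg_cpow {p q : ℝ} (hp : 0 < p) (hq : 0 < q) (hpq : p * q = 1) :
    ω⁻¹ * (-(p : ℂ)) ^ ((1 : ℂ) / 3) + ω * (-(p : ℂ)) ^ (-(1 : ℂ) / 3) =
      (-(q : ℂ)) ^ ((1 : ℂ) / 3) + (-(q : ℂ)) ^ (-(1 : ℂ) / 3) := by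
  have h := omega_mul_neg_cpow hp hq hpq
  have hinv : ω⁻¹ * (-(p : ℂ)) ^ ((1 : ℂ) / 3) = (-(q : ℂ)) ^ (-(1 : ℂ) / 3) := by
    rw [neg_div, cpow_neg, ← h, neg_div, cpow_neg, mul_inv, inv_inv]
  rw [h, hinv, add_comm]

/-- A root of norm at most one of `u² + (4z - 2)u + 1` tends to the root `-p` of the limiting
polynomial `(u + p)(u + q)` lying inside the unit disc. -/
lemma tendsto_small_root {l : Filter ℂ} {u : ℂ → ℂ} {p q x : ℝ} (hq : 1 < q)
    (hpq : p * q = 1) (hsum : p + q = 4 * x - 2) (hl : Tendsto id l (nhds (x : ℂ)))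
    (hu : ∀ᶠ z in l, ‖u z‖ ≤ 1 ∧ u z ^ 2 + 4 * z * u z - 2 * u z + 1 = 0) :
    Tendsto u l (nhds (-(p : ℂ))) := by
  have hz : Tendsto (fun z : ℂ => 4 * ‖z - x‖ / (q - 1)) l (nhds 0) := by
    have h := ((hl.sub_const (x : ℂ)).norm.const_mul 4).div_const (q - 1)
    simpa using h
  rw [tendsto_iff_norm_sub_tendsto_zero]
  refine squeeze_zero' (Eventually.of_forall fun _ => norm_nonneg _) (hu.mono ?_) hz
  rintro z ⟨hnorm, heq⟩
  have hpq' : (p : ℂ) * q = 1 := by exact_mod_cast hpq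
  have hsum' : (p : ℂ) + q = 4 * x - 2 := by exact_mod_cast hsum
  have hprod : (u z - -(p : ℂ)) * (u z + q) = -(4 * (z - x) * u z) := by
    linear_combination heq + hpq' + u z * hsum'
  have hnormprod : ‖u z - -(p : ℂ)‖ * ‖u z + q‖ = 4 * ‖z - x‖ * ‖u z‖ := by
    rw [← norm_mul, hprod, norm_neg, norm_mul, norm_mul]
    norm_num
  have hlower : q - 1 ≤ ‖u z + q‖ := by
    have h := norm_sub_le (u z + q) (u z)
    rw [add_sub_cancel_left, norm_real, Real.norm_of_nonneg (by linarith)] at h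
    linarith
  rw [le_div_iff₀ (by linarith)]
  calc ‖u z - -(p : ℂ)‖ * (q - 1) ≤ ‖u z - -(p : ℂ)‖ * ‖u z + q‖ := by gcongr
    _ = 4 * ‖z - x‖ * ‖u z‖ := hnormprod
    _ ≤ 4 * ‖z - x‖ := mul_le_of_le_one_right (by positivity) hnorm

lemma im_mul_normSq_sub_one {u z : ℂ} (hu : u ^ 2 + 4 * z * u - 2 * u + 1 = 0) :
    u.im * (normSq u - 1) = -4 * z.im * normSq u := by
  have h : u * normSq u + (starRingEnd ℂ) u = (2 - 4 * z) * normSq u := by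
    rw [← mul_conj]
    linear_combination (starRingEnd ℂ) u * hu
  have him := congrArg Complex.im h
  simp at him
  linarith

lemma norm_le_one_of_im_pos {u z : ℂ} (hpos : 0 < u.im)
    (hu : u ^ 2 + 4 * z * u - 2 * u + 1 = 0) (hz : 0 < z.im) : ‖u‖ ≤ 1 := by
  have h := im_mul_normSq_sub_one hu
  rw [normSq_eq_norm_sq] at h
  by_contra! hlt
  have h1 : 0 < u.im * (‖u‖ ^ 2 - 1) := mul_pos hpos (by nlinarith)
  have h2 : 0 ≤ z.im * ‖u‖ ^ 2 := by positivity
  linarith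

lemma norm_inv_le_one_of_im_neg {u z : ℂ} (hpos : 0 < u.im)
    (hu : u ^ 2 + 4 * z * u - 2 * u + 1 = 0) (hz : z.im < 0) : ‖u⁻¹‖ ≤ 1 := by
  have h := im_mul_normSq_sub_one hu
  rw [normSq_eq_norm_sq] at h
  rw [norm_inv]
  refine inv_le_one_of_one_le₀ ?_
  by_contra! hlt
  have h1 : 0 < u.im * (1 - ‖u‖ ^ 2) := mul_pos hpos (by nlinarith [norm_nonneg u])
  have h2 : 0 ≤ -z.im * ‖u‖ ^ 2 := mul_nonneg (by linarith) (sq_nonneg _)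
  linarith

lemma exists_boundary_roots {x : ℝ} (hx : 1 < x) :
    ∃ p q : ℝ, 0 < p ∧ 1 < q ∧ p * q = 1 ∧ p + q = 4 * x - 2 := by
  have hs := Real.sq_sqrt (show 0 ≤ x ^ 2 - x by nlinarith)
  have hs0 := Real.sqrt_nonneg (x ^ 2 - x)
  set s := √(x ^ 2 - x)
  have hq : 1 < 2 * x - 1 + 2 * s := by linarith
  have hpq : (2 * x - 1 - 2 * s) * (2 * x - 1 + 2 * s) = 1 := by linear_combination -4 * hs
  exact ⟨2 * x - 1 - 2 * s, 2 * x - 1 + 2 * s,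
    pos_of_mul_pos_left (hpq ▸ one_pos) (by linarith), hq, hpq, by ring⟩

/-- Boundary values on `(1,∞)`: `w₂,±(x) = w₁,∓(x)`. -/
theorem w2_w1_boundary_values_right_axis
    (η : ℂ → ℂ)
    (hη : ∀ z ∈ Ω, 0 < (η z).im ∧ (η z) ^ 2 + 4 * z * (η z) - 2 * (η z) + 1 = 0)
    (w₁ w₂ w₃ : ℂ → ℂ)
    (hw₁ : ∀ z, w₁ z = (1 / 2) * ((η z) ^ ((1 : ℂ) / 3) + (η z) ^ (-(1 : ℂ) / 3) + 1))
    (hw₂ : ∀ z, w₂ z = (1 / 2) * (ω⁻¹ * (η z) ^ ((1 : ℂ) / 3) + ω * (η z) ^ (-(1 : ℂ) / 3) + 1))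
    (hw₃ : ∀ z, w₃ z = (1 / 2) * (ω * (η z) ^ ((1 : ℂ) / 3) + ω⁻¹ * (η z) ^ (-(1 : ℂ) / 3) + 1))
    (x : ℝ) (hx : 1 < x) :
    ∃ Lp Lm : ℂ,
      Filter.Tendsto w₂ (nhdsWithin (x : ℂ) ({z : ℂ | 0 < z.im} ∩ Ω)) (nhds Lp) ∧
      Filter.Tendsto w₁ (nhdsWithin (x : ℂ) ({z : ℂ | z.im < 0} ∩ Ω)) (nhds Lp) ∧
      Filter.Tendsto w₂ (nhdsWithin (x : ℂ) ({z : ℂ | z.im < 0} ∩ Ω)) (nhds Lm) ∧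
      Filter.Tendsto w₁ (nhdsWithin (x : ℂ) ({z : ℂ | 0 < z.im} ∩ Ω)) (nhds Lm) := by
  obtain ⟨p, q, hp, hq, hpq, hsum⟩ := exists_boundary_roots hx
  have hq0 : 0 < q := by linarith
  have hupper : ∀ᶠ z in nhdsWithin (x : ℂ) ({z : ℂ | 0 < z.im} ∩ Ω), 0 < z.im ∧ z ∈ Ω :=
    eventually_mem_nhdsWithin
  have hlower : ∀ᶠ z in nhdsWithin (x : ℂ) ({z : ℂ | z.im < 0} ∩ Ω), z.im < 0 ∧ z ∈ Ω :=
    eventually_mem_nhdsWithin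
  have hηp : Tendsto η (nhdsWithin (x : ℂ) ({z : ℂ | 0 < z.im} ∩ Ω)) (nhds (-(p : ℂ))) :=
    tendsto_small_root hq hpq hsum (tendsto_id.mono_left nhdsWithin_le_nhds)
      (hupper.mono fun z hz =>
        ⟨norm_le_one_of_im_pos (hη z hz.2).1 (hη z hz.2).2 hz.1, (hη z hz.2).2⟩)
  have hηq : Tendsto η (nhdsWithin (x : ℂ) ({z : ℂ | z.im < 0} ∩ Ω)) (nhds (-(q : ℂ))) := by
    have hinv : Tendsto (fun z => (η z)⁻¹) (nhdsWithin (x : ℂ) ({z : ℂ | z.im < 0} ∩ Ω))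
        (nhds (-(p : ℂ))) := by
      refine tendsto_small_root hq hpq hsum (tendsto_id.mono_left nhdsWithin_le_nhds)
        (hlower.mono fun z hz => ⟨norm_inv_le_one_of_im_neg (hη z hz.2).1 (hη z hz.2).2 hz.1, ?_⟩)
      obtain ⟨hpos, heq⟩ := hη z hz.2
      have hne : η z ≠ 0 := fun h => by simp [h] at hpos
      field_simp
      linear_combination heq
    have h := hinv.inv₀ (by simpa using hp.ne')
    rw [inv_neg, ← ofReal_inv, ← eq_inv_of_mul_eq_one_right hpq] at h
    simpa using h
  have hcpow_p := tendsto_cpow_const_of_im_pos (by simpa using hp) (by simp) hηp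
    (hupper.mono fun z hz => (hη z hz.2).1)
  have hcpow_q := tendsto_cpow_const_of_im_pos (by simpa using hq0) (by simp) hηq
    (hlower.mono fun z hz => (hη z hz.2).1)
  obtain rfl : w₁ = _ := funext hw₁
  obtain rfl : w₂ = _ := funext hw₂
  refine ⟨_, _, ?_, (((hcpow_q _).add (hcpow_q _)).add_const 1).const_mul _,
    ?_, (((hcpow_p _).add (hcpow_p _)).add_const 1).const_mul _⟩
  · rw [← omega_combination_neg_cpow hp hq0 hpq]
    exact ((((hcpow_p _).const_mul _).add ((hcpow_p _).const_mul _)).add_const 1).const_mul _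
  · rw [← omega_combination_neg_cpow hq0 hp (by rw [mul_comm, hpq])]
    exact ((((hcpow_q _).const_mul _).add ((hcpow_q _).const_mul _)).add_const 1).const_mul _
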